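/- arXiv:0705.4330 — 4 statements merged into one kernel-verified Lean document; each statement's English description precedes it below -/
import Mathlib

section
/- Let F be a number field, n ≥ 1, and a₁, …, aₙ ∈ F with every aᵢ ≠ 0. Let S be a finite set of real embeddings of F such that for every σ ∈ S there is some index i with σ(aᵢ) > 0. Then there exist b₁, …, bₙ ∈ F such that the element c := Σᵢ aᵢ·bᵢ² is nonzero and satisfies σ(c) > 0 for every σ ∈ S. -/
open NumberField in
theorem mk_real_inj {F : Type*} [Field F] (σ τ : F →+* ℝ)
    (h : InfinitePlace.mk (Complex.ofRealHom.comp σ) =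
      InfinitePlace.mk (Complex.ofRealHom.comp τ)) : σ = τ := by
  rw [InfinitePlace.mk_eq_iff] at h
  ext x
  rcases h with h | h
  · have := RingHom.congr_fun h x
    simpa using this
  · have := RingHom.congr_fun h x
    simpa [ComplexEmbedding.conjugate_coe_eq] using this

open NumberField in
theorem approx_indicator {F : Type*} [Field F] [NumberField F] (T : Set (F →+* ℝ))
    (ε : ℝ) (hε : 0 < ε) :
    ∃ x : F, ∀ σ : F →+* ℝ, (σ ∈ T → |σ x - 1| < ε) ∧ (σ ∉ T → |σ x| < ε) := by
  classical
  let t : InfinitePlace F → F := fun v =>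
    if ∃ σ ∈ T, InfinitePlace.mk (Complex.ofRealHom.comp σ) = v then 1 else 0
  obtain ⟨x, hx⟩ := Metric.denseRange_iff.1 (InfinitePlace.denseRange_algebraMap_pi F)
    (fun v => (WithAbs.equiv v.1).symm (t v)) ε hε
  have key : ∀ σ : F →+* ℝ,
      |σ (x - t (InfinitePlace.mk (Complex.ofRealHom.comp σ)))| < ε := by
    intro σ
    have h1 := (dist_pi_lt_iff hε).1 hx (InfinitePlace.mk (Complex.ofRealHom.comp σ))
    rw [dist_comm, dist_eq_norm] at h1
    have h2 : (InfinitePlace.mk (Complex.ofRealHom.comp σ))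
      (x - t (InfinitePlace.mk (Complex.ofRealHom.comp σ))) < ε := h1
    rw [InfinitePlace.apply] at h2
    simpa only [RingHom.comp_apply, Complex.ofRealHom_eq_coe, Complex.norm_real,
      Real.norm_eq_abs] using h2
  refine ⟨x, fun σ => ⟨fun h => ?_, fun h => ?_⟩⟩
  · have ht : t (InfinitePlace.mk (Complex.ofRealHom.comp σ)) = 1 := if_pos ⟨σ, h, rfl⟩
    have := key σ
    rwa [ht, map_sub, map_one] at this
  · have ht : t (InfinitePlace.mk (Complex.ofRealHom.comp σ)) = 0 := by
      refine if_neg ?_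
      rintro ⟨τ, hτ, he⟩
      exact h (mk_real_inj _ _ he ▸ hτ)
    have := key σ
    rwa [ht, sub_zero] at this


/-- Weak approximation step: given nonzero `a₁, …, aₙ` in a number field `F` and a
finite set `S` of real embeddings at each of which some `aᵢ` is positive, there are
`b₁, …, bₙ ∈ F` with `c = Σ aᵢ bᵢ²` nonzero and positive at every embedding in `S`. -/
theorem stmt_4 (F : Type*) [Field F] [NumberField F] (n : ℕ) (hn : 1 ≤ n)
    (a : Fin n → F) (ha : ∀ i, a i ≠ 0) (S : Finset (F →+* ℝ))
    (hS : ∀ σ ∈ S, ∃ i, 0 < σ (a i)) :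
    ∃ b : Fin n → F,
      (∑ i, a i * b i ^ 2) ≠ 0 ∧ ∀ σ ∈ S, 0 < σ (∑ i, a i * b i ^ 2) := by
  classical
  rcases S.eq_empty_or_nonempty with rfl | ⟨σ₀, hσ₀⟩
  · let i₀ : Fin n := ⟨0, hn⟩
    refine ⟨Pi.single i₀ 1, ?_, by simp⟩
    rw [Finset.sum_eq_single i₀]
    · simpa using ha i₀
    · intro j _ hj
      simp [hj]
    · simp
  have hi : ∀ σ : F →+* ℝ, ∃ i, σ ∈ S → 0 < σ (a i) := by
    intro σ
    by_cases h : σ ∈ S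
    · obtain ⟨i, hi⟩ := hS σ h
      exact ⟨i, fun _ => hi⟩
    · exact ⟨⟨0, hn⟩, fun h' => absurd h' h⟩
  choose k hk using hi
  have hev : ∀ᶠ ε in nhdsWithin (0 : ℝ) (Set.Ioi 0),
      ∀ σ ∈ S, (∑ i, |σ (a i)|) * ε ^ 2 < σ (a (k σ)) / 4 := by
    rw [Filter.eventually_all_finset]
    intro σ hσ
    have hc : Filter.Tendsto (fun ε : ℝ => (∑ i, |σ (a i)|) * ε ^ 2) (nhds 0) (nhds 0) := by
      have : Continuous (fun ε : ℝ => (∑ i, |σ (a i)|) * ε ^ 2) := by fun_prop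
      simpa using this.tendsto 0
    exact (hc.mono_left nhdsWithin_le_nhds).eventually_lt_const (by have := hk σ hσ; positivity)
  have hhalf : ∀ᶠ ε in nhdsWithin (0 : ℝ) (Set.Ioi 0), ε < 1 / 2 :=
    nhdsWithin_le_nhds (Iio_mem_nhds (by norm_num))
  obtain ⟨ε, ⟨h1, h2⟩, h3⟩ := ((hev.and hhalf).and self_mem_nhdsWithin).exists
  choose b hb using fun i => approx_indicator {σ : F →+* ℝ | k σ = i} ε h3
  have main : ∀ σ ∈ S, 0 < σ (∑ i, a i * b i ^ 2) := by
    intro σ hσ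
    have hp := hk σ hσ
    have e1 := h1 σ hσ
    have hge : ∀ i, (if i = k σ then σ (a i) / 4 else 0) - |σ (a i)| * ε ^ 2
        ≤ σ (a i) * σ (b i) ^ 2 := by
      intro i
      split_ifs with h
      · subst h
        have h4 := abs_lt.1 ((hb (k σ) σ).1 rfl)
        have h5 : 1 / 4 ≤ σ (b (k σ)) ^ 2 := by nlinarith
        have h6 : 0 ≤ |σ (a (k σ))| * ε ^ 2 := by positivity
        nlinarith
      · have h4 := (hb i σ).2 (fun h' => h h'.symm)
        have h5 : σ (b i) ^ 2 ≤ ε ^ 2 := sq_le_sq' (abs_lt.1 h4).1.le (abs_lt.1 h4).2.le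
        have h6 := mul_le_mul_of_nonneg_left h5 (abs_nonneg (σ (a i)))
        have h7 := mul_le_mul_of_nonneg_right (neg_abs_le (σ (a i))) (sq_nonneg (σ (b i)))
        linarith
    have hsum := Finset.sum_le_sum (fun i (_ : i ∈ Finset.univ) => hge i)
    rw [Finset.sum_sub_distrib, ← Finset.sum_mul, Finset.sum_ite_eq' ] at hsum
    simp only [Finset.mem_univ, if_true] at hsum
    simp only [map_sum, map_mul, map_pow]
    linarith
  refine ⟨b, fun h0 => ?_, main⟩
  have := main σ₀ hσ₀
  rw [h0, map_zero] at this
  exact lt_irrefl _ this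
end

section
/- Let F be a number field and S a finite set of real embeddings of F. Then there exists a ∈ F such that a is not a square in F and σ(a) > 0 for every σ ∈ S. (Equivalently: a is a square in the completion of F at every place in S, but not a square in F.) -/
/-- In a number field `F`, given any finite set `S` of real embeddings, there is an
element `a ∈ F` that is not a square in `F` but is positive (hence a square in the
real completion) at every embedding in `S`. -/
theorem stmt_5 (F : Type*) [Field F] [NumberField F] (S : Finset (F →+* ℝ)) :
    ∃ a : F, ¬ IsSquare a ∧ ∀ σ ∈ S, 0 < σ a := by
  obtain ⟨P, hP⟩ := Ideal.exists_maximal (NumberField.RingOfIntegers F)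
  have hP0 : P ≠ ⊥ := Ring.ne_bot_of_isMaximal_of_not_isField hP
    (NumberField.RingOfIntegers.not_isField F)
  obtain ⟨a, ha1, ha2⟩ := Ideal.exists_mem_pow_notMem_pow_succ P hP0 hP.ne_top 1
  rw [pow_one] at ha1
  have hn0 : 0 < Ideal.absNorm P :=
    Nat.pos_of_ne_zero (fun h => hP0 (Ideal.absNorm_eq_zero_iff.mp h))
  have hnP := Ideal.absNorm_mem P
  set n := Ideal.absNorm P
  obtain ⟨M, hM⟩ : ∃ M : ℕ, ∀ σ ∈ S, -σ (a : F) < M := by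
    obtain ⟨B, hB⟩ := (S.image (fun σ => -σ (a : F))).bddAbove
    obtain ⟨M, hM⟩ := exists_nat_gt B
    exact ⟨M, fun σ hσ => lt_of_le_of_lt
      (hB (Finset.mem_coe.mpr (Finset.mem_image_of_mem _ hσ))) hM⟩
  have hN : ((n : NumberField.RingOfIntegers F) ^ 2 * M) ∈ P ^ 2 :=
    Ideal.mul_mem_right _ _ (Ideal.pow_mem_pow hnP 2)
  refine ⟨((a + n ^ 2 * M : NumberField.RingOfIntegers F) : F), ?_, ?_⟩
  · rintro ⟨x, hx⟩
    have hxi : IsIntegral ℤ x := by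
      apply IsIntegral.of_pow (n := 2) (by norm_num)
      rw [pow_two, ← hx]
      exact NumberField.RingOfIntegers.isIntegral_coe _
    obtain ⟨y, rfl⟩ : ∃ y : NumberField.RingOfIntegers F, (y : F) = x := ⟨⟨x, hxi⟩, rfl⟩
    have hy : a + n ^ 2 * M = y ^ 2 := by
      apply NumberField.RingOfIntegers.ext
      rw [hx, pow_two]
      rfl
    have hyP : y ^ 2 ∈ P := by
      rw [← hy]
      exact P.add_mem ha1 (Ideal.pow_le_self (by norm_num) hN)
    have h2 := Ideal.pow_mem_pow (hP.isPrime.mem_of_pow_mem 2 hyP) 2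
    rw [← hy] at h2
    exact ha2 ((Ideal.add_mem_iff_left _ hN).mp h2)
  · intro σ hσ
    have h1 := hM σ hσ
    have h2 : (1 : ℝ) ≤ n := by exact_mod_cast hn0
    have h3 : (0 : ℝ) ≤ M := Nat.cast_nonneg M
    have h4 : (M : ℝ) ≤ n ^ 2 * M := le_mul_of_one_le_left h3 (one_le_pow₀ h2)
    simp only [map_add, map_mul, map_pow, map_natCast]
    linarith
end

section
/- Let F be a field of characteristic different from 2, let c₁, c₂ ∈ F, and let α ∈ ℍ[F, c₁, c₂] be a pure quaternion such that α·α = s·1 for some s ∈ F that is not a square in F. Then every x ∈ ℍ[F, c₁, c₂] that commutes with α (x·α = α·x) lies in the F-span of 1 and α; that is, there exist u, v ∈ F with x = u·1 + v·α. -/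
open Quaternion

/-- If `α` is a pure quaternion with `α² = s·1` for `s` not a square in `F`, then the
centralizer of `α` in `ℍ[F, c₁, c₂]` is the `F`-span of `1` and `α`. -/
theorem stmt_7 {F : Type*} [Field F] (hchar : ringChar F ≠ 2) (c₁ c₂ : F)
    (α : ℍ[F, c₁, c₂]) (hα : α.re = 0) (s : F) (hs : α * α = s • (1 : ℍ[F, c₁, c₂]))
    (hs' : ¬ IsSquare s) (x : ℍ[F, c₁, c₂]) (hx : x * α = α * x) :
    ∃ u v : F, x = u • (1 : ℍ[F, c₁, c₂]) + v • α := by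
  have h2 : (2 : F) ≠ 0 := Ring.two_ne_zero hchar
  have hs0 : s ≠ 0 := by
    rintro rfl
    exact hs' (IsSquare.zero)
  obtain ⟨r0, p, q, r⟩ := α
  obtain ⟨t, a, b, c⟩ := x
  simp only at hα
  subst hα
  have e0 := congrArg QuaternionAlgebra.re hs
  have eI := congrArg QuaternionAlgebra.imI hx
  have eJ := congrArg QuaternionAlgebra.imJ hx
  have eK := congrArg QuaternionAlgebra.imK hx
  simp at e0 eI eJ eK
  have hI : c₂ * (b * r - c * q) = 0 := by
    apply (mul_eq_zero.mp (?_ : 2 * (c₂ * (b * r - c * q)) = 0)).resolve_left h2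
    first | linear_combination eI | linear_combination -eI
  have hJ : c₁ * (a * r - c * p) = 0 := by
    apply (mul_eq_zero.mp (?_ : 2 * (c₁ * (a * r - c * p)) = 0)).resolve_left h2
    first | linear_combination eJ | linear_combination -eJ
  have hK : a * q - b * p = 0 := by
    apply (mul_eq_zero.mp (?_ : 2 * (a * q - b * p) = 0)).resolve_left h2
    first | linear_combination eK | linear_combination -eK
  refine ⟨t, (c₁ * a * p + c₂ * b * q - c₁ * c₂ * c * r) / s, ?_⟩
  ext
  · simp
  · simp
    field_simp
    linear_combination -a * e0 + c₂ * q * hK - c₂ * r * hJ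
  · simp
    field_simp
    linear_combination -b * e0 - c₁ * p * hK - c₁ * r * hI
  · simp
    field_simp
    linear_combination -c * e0 - p * hJ - q * hI
end

section
/- Let F be a number field, let a, b ∈ F be nonzero, let S be a finite set of real embeddings of F, and let T ⊆ S be a subset such that every σ ∈ S with σ(a) < 0 and σ(b) < 0 belongs to T. Then there exists e ∈ F, e ≠ 0, such that: e is not a square in F; σ(e) < 0 for every σ ∈ T; σ(e) > 0 for every σ ∈ S \ T; and the quadratic form x₀² − a·x₁² − b·x₂² + a·b·x₃² is isotropic over the field F(√e) = F[X]/(X² − e), i.e. there exist x₀, x₁, x₂, x₃ ∈ F[X]/(X² − e), not all zero, with x₀² − a·x₁² − b·x₂² + a·b·x₃² = 0 (a, b taken via the canonical map F → F[X]/(X² − e)). (This quadratic form is the norm form of the quaternion algebra (a,b)_F, so the conclusion says (a,b)_F splits over F(√e).) -/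
open Polynomial

open Filter Topology NumberField in
theorem approx_real (F : Type*) [Field F] [NumberField F] (f : (F →+* ℝ) → F) :
    ∃ y : ℕ → F, ∀ σ : F →+* ℝ, Tendsto (fun n => σ (y n)) atTop (𝓝 (σ (f σ))) := by
  classical
  let m : (F →+* ℝ) → InfinitePlace F := fun σ => InfinitePlace.mk (Complex.ofRealHom.comp σ)
  have hm : Function.Injective m := by
    intro σ τ h
    have h2 : (Complex.ofRealHom.comp σ : F →+* ℂ) = Complex.ofRealHom.comp τ := by
      rcases InfinitePlace.mk_eq_iff.1 h with h | h
      · exact h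
      · rw [← h]
        ext x
        simp [ComplexEmbedding.conjugate_coe_eq]
    ext x
    have := RingHom.congr_fun h2 x
    simpa using this
  let z : (v : InfinitePlace F) → WithAbs v.1 := fun v =>
    (WithAbs.equiv v.1).symm (if h : ∃ σ, m σ = v then f h.choose else 0)
  have hz : ∀ σ, WithAbs.equiv (m σ).1 (z (m σ)) = f σ := by
    intro σ
    have h : ∃ τ, m τ = m σ := ⟨σ, rfl⟩
    have h3 : h.choose = σ := hm h.choose_spec
    simp only [z, RingEquiv.apply_symm_apply]
    rw [dif_pos h, h3]
  have key : ∀ n : ℕ, ∃ y : F, ∀ σ : F →+* ℝ, |σ y - σ (f σ)| < 1 / ((n : ℝ) + 1) := by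
    intro n
    have hpos : (0 : ℝ) < 1 / ((n : ℝ) + 1) := by positivity
    obtain ⟨y, hy⟩ := (InfinitePlace.denseRange_algebraMap_pi F).exists_dist_lt z hpos
    refine ⟨y, fun σ => ?_⟩
    have h1 := (dist_pi_lt_iff hpos).1 hy (m σ)
    rw [dist_comm, dist_eq_norm, WithAbs.norm_eq_apply_ofAbs] at h1
    have h2 : (m σ).1 (y - f σ) < 1 / ((n : ℝ) + 1) := by
      have := hz σ
      rw [← this]
      exact h1
    have h4 : (m σ).1 (y - f σ) = |σ y - σ (f σ)| := by
      change ‖(Complex.ofRealHom.comp σ) (y - f σ)‖ = _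
      rw [← map_sub]
      simp [-map_sub]
    rwa [h4] at h2
  choose y hy using key
  refine ⟨y, fun σ => ?_⟩
  rw [tendsto_iff_dist_tendsto_zero]
  refine squeeze_zero (fun _ => dist_nonneg) (fun n => ?_) tendsto_one_div_add_atTop_nhds_zero_nat
  rw [Real.dist_eq]
  exact (hy n σ).le

open NumberField in
theorem exists_nonsquare_pos (F : Type*) [Field F] [NumberField F] (S : Finset (F →+* ℝ)) :
    ∃ e : F, ¬ IsSquare e ∧ ∀ σ ∈ S, 0 < σ e := by
  classical
  obtain ⟨P, hP⟩ := Ideal.exists_maximal (𝓞 F)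
  have hP0 : P ≠ ⊥ := Ring.ne_bot_of_isMaximal_of_not_isField hP (RingOfIntegers.not_isField F)
  have hlt : P ^ 2 < P := Ideal.pow_lt_self P hP0 hP.ne_top 2 le_rfl
  obtain ⟨π, hπ, hπ2⟩ := Set.exists_of_ssubset hlt
  have hp : Ideal.absNorm P ≠ 0 := by
    rw [Ne, Ideal.absNorm_eq_zero_iff]; exact hP0
  set p : ℕ := Ideal.absNorm P
  have hpP : (p : 𝓞 F) ∈ P := Ideal.absNorm_mem P
  obtain ⟨k, hk⟩ : ∃ k : ℕ, ∀ σ ∈ S, -σ (π : F) < k := by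
    obtain ⟨k, hk⟩ := exists_nat_gt (∑ σ ∈ S, |σ (π : F)|)
    refine ⟨k, fun σ hσ => lt_of_le_of_lt ?_ hk⟩
    exact (neg_le_abs _).trans (Finset.single_le_sum (f := fun σ : F →+* ℝ => |σ (π : F)|)
      (fun _ _ => abs_nonneg _) hσ)
  let e : 𝓞 F := π + (p : 𝓞 F) ^ 2 * k
  have hn : (p : 𝓞 F) ^ 2 * k ∈ P ^ 2 := Ideal.mul_mem_right _ _ (Ideal.pow_mem_pow hpP 2)
  refine ⟨(e : F), ?_, ?_⟩
  · rintro ⟨s, hs⟩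
    have hsi : IsIntegral ℤ s := by
      refine IsIntegral.of_pow (n := 2) (by norm_num) ?_
      rw [sq, ← hs]
      exact e.isIntegral_coe
    obtain ⟨t, rfl⟩ : ∃ t : 𝓞 F, (t : F) = s := ⟨⟨s, hsi⟩, rfl⟩
    have het : e = t ^ 2 := by
      apply RingOfIntegers.ext
      rw [hs, sq]; simp
    have heP : e ∈ P := P.add_mem hπ (Ideal.pow_le_self two_ne_zero hn)
    have htP : t ∈ P := hP.isPrime.mem_of_pow_mem 2 (het ▸ heP)
    have heP2 : e ∈ P ^ 2 := by rw [het]; exact Ideal.pow_mem_pow htP 2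
    exact hπ2 (((P ^ 2).add_mem_iff_left hn).1 heP2)
  · intro σ hσ
    have h1 := hk σ hσ
    have h2 : σ (e : F) = σ (π : F) + (p : ℝ) ^ 2 * k := by simp [e]
    rw [h2]
    have h3 : (1 : ℝ) ≤ p := by exact_mod_cast Nat.one_le_iff_ne_zero.2 hp
    have h4 : (0 : ℝ) ≤ k := Nat.cast_nonneg k
    nlinarith [mul_nonneg h4 (by nlinarith : (0 : ℝ) ≤ (p : ℝ) ^ 2 - 1)]

theorem universal_of_square {F : Type*} [Field F] [CharZero F] (a b : F) (ha : a ≠ 0)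
    (hb : b ≠ 0) (x y z s : F) (hs : s ≠ 0)
    (h : a * x ^ 2 + b * y ^ 2 - a * b * z ^ 2 = s ^ 2) (e : F) :
    ∃ x y z : F, a * x ^ 2 + b * y ^ 2 - a * b * z ^ 2 = e := by
  by_cases hd : y ^ 2 - a * z ^ 2 = 0
  · have hx : a * x ^ 2 = s ^ 2 := by linear_combination h - b * hd
    refine ⟨0, (e - b) / (2 * b) + 1, (e - b) / (2 * b) * (x / s), ?_⟩
    have h1 : a * (x / s) ^ 2 = 1 := by
      rw [div_pow, ← mul_div_assoc, hx, div_self (pow_ne_zero 2 hs)]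
    have h2 : b * (2 * ((e - b) / (2 * b)) + 1) = e := by field_simp; ring
    linear_combination h2 - b * ((e - b) / (2 * b)) ^ 2 * h1
  · obtain ⟨p, r, hpr⟩ : ∃ p r : F, p ^ 2 - a * r ^ 2 = b := by
      refine ⟨(s * y - a * x * z) / (y ^ 2 - a * z ^ 2),
        (x * y - s * z) / (y ^ 2 - a * z ^ 2), ?_⟩
      field_simp
      linear_combination (-(y ^ 2 - a * z ^ 2)) * h
    refine ⟨(e - a) / (2 * a) + 1, -((e - a) / (2 * a)) * a * r / b,
      (e - a) / (2 * a) * p / b, ?_⟩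
    have h2 : a * (2 * ((e - a) / (2 * a)) + 1) = e := by field_simp; ring
    generalize (e - a) / (2 * a) = t at *
    rw [← h2]
    field_simp
    linear_combination (-t ^ 2) * hpr

open Filter Topology in
theorem exists_signs (F : Type*) [Field F] [NumberField F] (a b : F) (ha : a ≠ 0) (hb : b ≠ 0)
    (S T : Finset (F →+* ℝ)) 
    (hT : ∀ σ ∈ S, σ a < 0 → σ b < 0 → σ ∈ T) :
    ∃ x y z : F, (∀ σ ∈ T, σ (a * x ^ 2 + b * y ^ 2 - a * b * z ^ 2) < 0) ∧
      (∀ σ ∈ S, σ ∉ T → 0 < σ (a * x ^ 2 + b * y ^ 2 - a * b * z ^ 2)) := by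
  classical
  have loc : ∀ σ : F →+* ℝ, ∃ x y z : F,
      (σ ∈ T → σ (a * x ^ 2 + b * y ^ 2 - a * b * z ^ 2) < 0) ∧
      (σ ∈ S → σ ∉ T → 0 < σ (a * x ^ 2 + b * y ^ 2 - a * b * z ^ 2)) := by
    intro σ
    have ha' : σ a ≠ 0 := by simpa using ha
    have hb' : σ b ≠ 0 := by simpa using hb
    by_cases hσ : σ ∈ T
    · rcases lt_or_gt_of_ne ha' with h | h
      · exact ⟨1, 0, 0, by simpa using fun _ => h, fun _ h => absurd hσ h⟩
      rcases lt_or_gt_of_ne hb' with h1 | h1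
      · exact ⟨0, 1, 0, by simpa using fun _ => h1, fun _ h => absurd hσ h⟩
      · exact ⟨0, 0, 1, by simpa using fun _ => mul_pos h h1, fun _ h => absurd hσ h⟩
    · rcases lt_or_gt_of_ne ha' with h | h
      · rcases lt_or_gt_of_ne hb' with h1 | h1
        · exact ⟨0, 0, 0, fun h => absurd h hσ, fun hS => absurd (hT σ hS h h1) hσ⟩
        · exact ⟨0, 1, 0, fun h => absurd h hσ, by simpa using fun _ _ => h1⟩
      · exact ⟨1, 0, 0, fun h => absurd h hσ, by simpa using fun _ _ => h⟩
  choose x y z hneg hpos using loc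
  obtain ⟨X, hX⟩ := approx_real F x
  obtain ⟨Y, hY⟩ := approx_real F y
  obtain ⟨Z, hZ⟩ := approx_real F z
  have lim : ∀ σ : F →+* ℝ, Tendsto
      (fun n => σ (a * X n ^ 2 + b * Y n ^ 2 - a * b * Z n ^ 2)) atTop
      (𝓝 (σ (a * x σ ^ 2 + b * y σ ^ 2 - a * b * z σ ^ 2))) := by
    intro σ
    simp only [map_sub, map_add, map_mul, map_pow]
    exact ((((hX σ).pow 2).const_mul _).add (((hY σ).pow 2).const_mul _)).sub
      (((hZ σ).pow 2).const_mul _)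
  have e1 : ∀ᶠ n in atTop, ∀ σ ∈ T, σ (a * X n ^ 2 + b * Y n ^ 2 - a * b * Z n ^ 2) < 0 :=
    (Finset.eventually_all T).2 fun σ hσ => (lim σ).eventually_lt_const (hneg σ hσ)
  have e2 : ∀ᶠ n in atTop, ∀ σ ∈ S, σ ∉ T →
      0 < σ (a * X n ^ 2 + b * Y n ^ 2 - a * b * Z n ^ 2) := by
    refine (Finset.eventually_all S).2 fun σ hσ => ?_
    by_cases h : σ ∈ T
    · exact Eventually.of_forall fun _ h' => absurd h h'
    · filter_upwards [(lim σ).eventually_const_lt (hpos σ hσ h)] with n hn _ using hn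
  obtain ⟨n, h1, h2⟩ := (e1.and e2).exists
  exact ⟨X n, Y n, Z n, h1, h2⟩

theorem exists_main (F : Type*) [Field F] [NumberField F] (a b : F) (ha : a ≠ 0) (hb : b ≠ 0)
    (S T : Finset (F →+* ℝ)) 
    (hT : ∀ σ ∈ S, σ a < 0 → σ b < 0 → σ ∈ T) :
    ∃ e : F, ¬ IsSquare e ∧ (∀ σ ∈ T, σ e < 0) ∧ (∀ σ ∈ S, σ ∉ T → 0 < σ e) ∧
      ∃ x y z : F, a * x ^ 2 + b * y ^ 2 - a * b * z ^ 2 = e := by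
  obtain ⟨x, y, z, h1, h2⟩ := exists_signs F a b ha hb S T hT
  by_cases hsq : IsSquare (a * x ^ 2 + b * y ^ 2 - a * b * z ^ 2)
  · have hTe : ∀ σ, σ ∉ T := by
      intro σ hσ
      have := h1 σ hσ
      obtain ⟨s, hs⟩ := hsq
      rw [hs, map_mul] at this
      exact absurd this (not_lt.2 (mul_self_nonneg _))
    obtain ⟨e, he, hpos⟩ := exists_nonsquare_pos F S
    obtain ⟨s, hs⟩ := hsq
    by_cases hs0 : s = 0
    · have hSe : ∀ σ, σ ∉ S := by
        intro σ hσ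
        have := h2 σ hσ (hTe σ)
        rw [hs, hs0] at this
        simp at this
      by_cases hsa : IsSquare a
      · obtain ⟨t, ht⟩ := hsa
        have ht0 : t ≠ 0 := by
          rintro rfl
          exact ha (by rw [ht, mul_zero])
        refine ⟨e, he, fun σ hσ => absurd hσ (hTe σ), fun σ hσ => absurd hσ (hSe σ), ?_⟩
        exact universal_of_square a b ha hb 1 0 0 t ht0 (by linear_combination ht) e
      · exact ⟨a, hsa, fun σ hσ => absurd hσ (hTe σ), fun σ hσ => absurd hσ (hSe σ),
          1, 0, 0, by ring⟩
    · refine ⟨e, he, fun σ hσ => absurd hσ (hTe σ), fun σ hσ _ => hpos σ hσ, ?_⟩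
      exact universal_of_square a b ha hb x y z s hs0 (by rw [hs, sq]) e
  · exact ⟨_, hsq, h1, h2, x, y, z, rfl⟩

/-- Weak approximation plus the Hasse principle: there is a nonsquare `e ∈ F`,
negative exactly at the embeddings in `T` (among those in `S`), such that the norm
form `x₀² − a·x₁² − b·x₂² + a·b·x₃²` of the quaternion algebra `(a,b)_F` becomes
isotropic over `F(√e) = F[X]/(X² − e)`, i.e. `(a,b)_F` splits over `F(√e)`. -/
theorem stmt_11 (F : Type*) [Field F] [NumberField F] (a b : F) (ha : a ≠ 0) (hb : b ≠ 0)
    (S T : Finset (F →+* ℝ)) (hTS : T ⊆ S)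
    (hT : ∀ σ ∈ S, σ a < 0 → σ b < 0 → σ ∈ T) :
    ∃ e : F, e ≠ 0 ∧ ¬ IsSquare e ∧
      (∀ σ ∈ T, σ e < 0) ∧ (∀ σ ∈ S, σ ∉ T → 0 < σ e) ∧
      ∃ x₀ x₁ x₂ x₃ : AdjoinRoot (X ^ 2 - C e),
        ¬ (x₀ = 0 ∧ x₁ = 0 ∧ x₂ = 0 ∧ x₃ = 0) ∧
        x₀ ^ 2 - AdjoinRoot.of (X ^ 2 - C e) a * x₁ ^ 2
          - AdjoinRoot.of (X ^ 2 - C e) b * x₂ ^ 2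
          + AdjoinRoot.of (X ^ 2 - C e) a * AdjoinRoot.of (X ^ 2 - C e) b * x₃ ^ 2 = 0 := by

  obtain ⟨e, he, h1, h2, x, y, z, hxyz⟩ := exists_main F a b ha hb S T hT
  have he0 : e ≠ 0 := by
    rintro rfl
    exact he (IsSquare.zero)
  refine ⟨e, he0, he, h1, h2, AdjoinRoot.root _, AdjoinRoot.of _ x, AdjoinRoot.of _ y,
    AdjoinRoot.of _ z, ?_, ?_⟩
  · rintro ⟨-, hx, hy, hz⟩
    have hdeg : (X ^ 2 - C e : F[X]).degree ≠ 0 := by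
      rw [degree_X_pow_sub_C (by norm_num)]; norm_num
    have hinj := AdjoinRoot.of.injective_of_degree_ne_zero hdeg
    rw [map_eq_zero_iff _ hinj] at hx hy hz
    subst hx hy hz
    apply he0
    rw [← hxyz]; ring
  · have hr : AdjoinRoot.root (X ^ 2 - C e) ^ 2 = AdjoinRoot.of (X ^ 2 - C e) e := by
      have := AdjoinRoot.eval₂_root (X ^ 2 - C e)
      simpa [sub_eq_zero] using this
    have hm := congrArg (AdjoinRoot.of (X ^ 2 - C e)) hxyz
    simp only [map_sub, map_add, map_mul, map_pow] at hm
    linear_combination hr - hm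
end
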